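/- Let F be a polarized rigid graphing function (analytic near the origin of ℂ², holomorphic in each variable, satisfying the reality condition) with F(0,0) = 0 and with Taylor coefficient F_{1,1} real and F_{1,1} > 0. Then there exist holomorphic functions f, g near 0 ∈ ℂ with f(0) = g(0) = 0 and f'(0) ≠ 0, and an analytic function F' near (0,0) holomorphic in each variable, satisfying the fundamental equation F'(f(z), f̄(w)) = F(z,w) + (1/2)g(z) + (1/2)ḡ(w) near (0,0), such that: F'(z,0) ≡ 0, F'(0,w) ≡ 0, ∂_w F'(z,0) ≡ z, ∂_z F'(0,w) ≡ w, and the Taylor coefficient of z²w² of F' equals (F_{2,2}·F_{1,1} − F_{2,1}·F_{1,2})/(F_{1,1})³. -/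

import Mathlib

open Complex Filter Topology ComplexConjugate

/-- Partial derivative in the first (`z`) slot. -/
noncomputable def pd1 (F : ℂ → ℂ → ℂ) : ℂ → ℂ → ℂ := fun z w => deriv (fun t => F t w) z

/-- Partial derivative in the second (`w`) slot. -/
noncomputable def pd2 (F : ℂ → ℂ → ℂ) : ℂ → ℂ → ℂ := fun z w => deriv (fun t => F z t) w

/-- Polarized rigid graphing function: analytic near the origin of `ℂ²` (hence holomorphic
in each of the two variables), and satisfying the reality condition near the origin. -/
def IsPolarizedRigid (F : ℂ → ℂ → ℂ) : Prop :=
  AnalyticAt ℂ (fun p : ℂ × ℂ => F p.1 p.2) 0 ∧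
    ∀ᶠ p : ℂ × ℂ in 𝓝 0, F p.1 p.2 = conj (F (conj p.2) (conj p.1))

/-- Taylor coefficient of `z^j w^k` in the expansion of `F` at the origin. -/
noncomputable def coeff2 (F : ℂ → ℂ → ℂ) (j k : ℕ) : ℂ :=
  (pd1^[j] (pd2^[k] F)) 0 0 / ((j.factorial : ℂ) * (k.factorial : ℂ))


theorem AnalyticAt.uncurry_pd2 {F : ℂ → ℂ → ℂ} {p : ℂ × ℂ}
    (hF : AnalyticAt ℂ (fun q : ℂ × ℂ => F q.1 q.2) p) :
    AnalyticAt ℂ (fun q : ℂ × ℂ => pd2 F q.1 q.2) p := by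
  have h : AnalyticAt ℂ
      (fun q : ℂ × ℂ => fderiv ℂ (fun q : ℂ × ℂ => F q.1 q.2) q (0, 1)) p :=
    (ContinuousLinearMap.apply ℂ ℂ ((0 : ℂ), (1 : ℂ))).analyticAt _ |>.comp hF.fderiv
  refine h.congr ?_
  filter_upwards [hF.eventually_analyticAt] with q hq
  have h2 : HasDerivAt (fun t : ℂ => (q.1, t)) ((0 : ℂ), (1 : ℂ)) q.2 :=
    (hasDerivAt_const q.2 q.1).prodMk (hasDerivAt_id q.2)
  exact (hq.differentiableAt.hasFDerivAt.comp_hasDerivAt (x := q.2) (f := fun t => (q.1, t))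
    h2).deriv.symm

theorem hasDerivAt_conj_comp_conj {k : ℂ → ℂ} {z : ℂ} (hk : DifferentiableAt ℂ k (conj z)) :
    HasDerivAt (fun t => conj (k (conj t))) (conj (deriv k (conj z))) z := by
  have h : HasFDerivAt k (fderiv ℂ k (conj z)) (star z) := hk.hasFDerivAt
  have h2 := h.star_star.hasDerivAt
  rw [star_star] at h2
  refine HasDerivAt.congr_deriv (f := star ∘ k ∘ star) h2 ?_
  simp [fderiv_eq_smul_deriv]

theorem analyticAt_conj_comp_conj {k : ℂ → ℂ} {z : ℂ} (hk : AnalyticAt ℂ k (conj z)) :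
    AnalyticAt ℂ (fun t => conj (k (conj t))) z := by
  rw [Complex.analyticAt_iff_eventually_differentiableAt]
  have hc : Tendsto (fun t : ℂ => conj t) (𝓝 z) (𝓝 (conj z)) :=
    Complex.continuous_conj.continuousAt
  filter_upwards [hc.eventually hk.eventually_analyticAt] with t ht
  exact (hasDerivAt_conj_comp_conj ht.differentiableAt).differentiableAt

/-- A holomorphic germ with nonzero derivative fixing the origin has a holomorphic inverse germ. -/
theorem AnalyticAt.exists_local_inverse {f : ℂ → ℂ} (hf : AnalyticAt ℂ f 0) (hf0 : f 0 = 0)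
    (hf' : deriv f 0 ≠ 0) :
    ∃ φ : ℂ → ℂ, AnalyticAt ℂ φ 0 ∧ φ 0 = 0 ∧ (∀ᶠ z in 𝓝 0, φ (f z) = z) ∧
      ∀ᶠ x in 𝓝 0, f (φ x) = x := by
  refine ⟨hf.hasStrictDerivAt.localInverse _ _ _ hf', ?_, ?_, ?_, ?_⟩
  · simpa only [hf0] using hf.analyticAt_localInverse hf'
  · have : hf.hasStrictDerivAt.localInverse _ _ _ hf' (f 0) = 0 :=
      HasStrictFDerivAt.localInverse_apply_image ..
    rwa [hf0] at this
  · exact HasStrictDerivAt.eventually_left_inverse hf.hasStrictDerivAt hf'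
  · have := HasStrictDerivAt.eventually_right_inverse hf.hasStrictDerivAt hf'
    rwa [hf0] at this

theorem deriv_comp_eventuallyEq {A φ : ℂ → ℂ} {p : ℂ} (hA : AnalyticAt ℂ A (φ p))
    (hφ : AnalyticAt ℂ φ p) :
    deriv (fun x => A (φ x)) =ᶠ[𝓝 p] fun x => deriv A (φ x) * deriv φ x := by
  filter_upwards [hφ.continuousAt.eventually hA.eventually_analyticAt,
    hφ.eventually_analyticAt] with x hx1 hx2
  exact deriv_comp x hx1.differentiableAt hx2.differentiableAt

theorem deriv_deriv_comp {A φ : ℂ → ℂ} {p : ℂ} (hA : AnalyticAt ℂ A (φ p))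
    (hφ : AnalyticAt ℂ φ p) :
    deriv (deriv (fun x => A (φ x))) p =
      deriv (deriv A) (φ p) * deriv φ p ^ 2 + deriv A (φ p) * deriv (deriv φ) p := by
  rw [(deriv_comp_eventuallyEq hA hφ).deriv_eq]
  have h1 : HasDerivAt (fun x => deriv A (φ x)) (deriv (deriv A) (φ p) * deriv φ p) p :=
    HasDerivAt.comp p hA.deriv.differentiableAt.hasDerivAt hφ.differentiableAt.hasDerivAt
  refine (h1.mul hφ.deriv.differentiableAt.hasDerivAt).deriv.trans ?_
  ring

theorem deriv_deriv_sub_const_sub {A B : ℂ → ℂ} {p : ℂ} (c : ℂ) (hA : AnalyticAt ℂ A p)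
    (hB : AnalyticAt ℂ B p) :
    deriv (deriv (fun t => A t - c - B t)) p = deriv (deriv A) p - deriv (deriv B) p := by
  have h : deriv (fun t => A t - c - B t) =ᶠ[𝓝 p] fun t => deriv A t - deriv B t := by
    filter_upwards [hA.eventually_analyticAt, hB.eventually_analyticAt] with t h1 h2
    exact ((h1.differentiableAt.hasDerivAt.sub_const c).sub h2.differentiableAt.hasDerivAt).deriv
  rw [h.deriv_eq]
  exact (hA.deriv.differentiableAt.hasDerivAt.sub hB.deriv.differentiableAt.hasDerivAt).deriv

theorem deriv_deriv_mul_add_linear {A : ℂ → ℂ} {p : ℂ} (n k m : ℂ) (hA : AnalyticAt ℂ A p) :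
    deriv (deriv (fun t => (A t - n) * k + m * t)) p = deriv (deriv A) p * k := by
  have h : deriv (fun t => (A t - n) * k + m * t) =ᶠ[𝓝 p] fun t => deriv A t * k + m := by
    filter_upwards [hA.eventually_analyticAt] with t h1
    refine (((h1.differentiableAt.hasDerivAt.sub_const n).mul_const k).add
      ((hasDerivAt_id t).const_mul m)).deriv.trans ?_
    rw [mul_one]
  rw [h.deriv_eq]
  exact ((hA.deriv.differentiableAt.hasDerivAt.mul_const k).add_const m).deriv

/-- The reality condition exchanges the two partial derivatives. -/
theorem IsPolarizedRigid.pd1_zero_eq_conj {F : ℂ → ℂ → ℂ} (hF : IsPolarizedRigid F) :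
    ∀ᶠ w in 𝓝 (0 : ℂ), pd1 F 0 w = conj (pd2 F (conj w) 0) := by
  have hc : Tendsto (fun w : ℂ => ((0 : ℂ), w)) (𝓝 0) (𝓝 (0 : ℂ × ℂ)) :=
    Continuous.tendsto' (by fun_prop) _ _ rfl
  have hc2 : Tendsto (fun w : ℂ => (conj w, (0 : ℂ))) (𝓝 0) (𝓝 (0 : ℂ × ℂ)) :=
    Continuous.tendsto' (by fun_prop) _ _ (by simp)
  filter_upwards [hc.eventually hF.2.eventually_nhds,
    hc2.eventually hF.1.eventually_analyticAt] with w hw hw2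
  have hc3 : Tendsto (fun t : ℂ => (t, w)) (𝓝 0) (𝓝 ((0 : ℂ), w)) :=
    Continuous.tendsto' (by fun_prop) _ _ rfl
  have h : (fun t => F t w) =ᶠ[𝓝 0] fun t => conj (F (conj w) (conj t)) := hc3.eventually hw
  have hd : DifferentiableAt ℂ (F (conj w)) (conj (0 : ℂ)) := by
    rw [map_zero]
    exact hw2.curry_right.differentiableAt
  have := (hasDerivAt_conj_comp_conj hd).deriv
  rw [map_zero] at this
  exact h.deriv_eq.trans this

/-- prenormalization of a Levi nondegenerate rigid hypersurface in `ℂ²`,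
with the resulting coefficient of `z²w²` equal to
`(F_{2,2}F_{1,1} − F_{2,1}F_{1,2})/F_{1,1}³`. -/
theorem stmt4
    (F : ℂ → ℂ → ℂ) (hF : IsPolarizedRigid F) (hF0 : F 0 0 = 0)
    (h11re : (coeff2 F 1 1).im = 0) (h11pos : 0 < (coeff2 F 1 1).re) :
    ∃ f g : ℂ → ℂ,
      AnalyticAt ℂ f 0 ∧ AnalyticAt ℂ g 0 ∧ f 0 = 0 ∧ g 0 = 0 ∧ deriv f 0 ≠ 0 ∧
      ∃ F' : ℂ → ℂ → ℂ,
        AnalyticAt ℂ (fun p : ℂ × ℂ => F' p.1 p.2) 0 ∧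
        (∀ᶠ p : ℂ × ℂ in 𝓝 0,
          F' (f p.1) (conj (f (conj p.2))) =
            F p.1 p.2 + (1 / 2) * g p.1 + (1 / 2) * conj (g (conj p.2))) ∧
        (∀ᶠ z in 𝓝 (0 : ℂ), F' z 0 = 0 ∧ pd2 F' z 0 = z) ∧
        (∀ᶠ w in 𝓝 (0 : ℂ), F' 0 w = 0 ∧ pd1 F' 0 w = w) ∧
        coeff2 F' 2 2 =
          (coeff2 F 2 2 * coeff2 F 1 1 - coeff2 F 2 1 * coeff2 F 1 2) /
            (coeff2 F 1 1) ^ 3 := by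
  set a : ℂ := pd1 (pd2 F) 0 0 with ha
  have h11 : coeff2 F 1 1 = a := by simp [coeff2, ha]
  rw [h11] at h11re h11pos
  set c : ℂ := ((Real.sqrt a.re : ℝ) : ℂ) with hc
  have hcc : c ^ 2 = a := by
    rw [hc, ← Complex.ofReal_pow, Real.sq_sqrt h11pos.le]
    exact Complex.ext rfl (by simp [h11re])
  have hcconj : conj c = c := Complex.conj_ofReal _
  have hc0 : c ≠ 0 := by
    rw [hc, Complex.ofReal_ne_zero]
    exact (Real.sqrt_pos.2 h11pos).ne'
  clear_value c
  have hFa := hF.1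
  have hFw := hFa.uncurry_pd2
  have hFww := hFw.uncurry_pd2
  have hFz0 : AnalyticAt ℂ (fun z => F z 0) 0 := hFa.curry_left
  have hF0w : AnalyticAt ℂ (fun w => F 0 w) 0 := hFa.curry_right
  have hFw0 : AnalyticAt ℂ (fun z => pd2 F z 0) 0 := hFw.curry_left
  have hFww0 : AnalyticAt ℂ (fun z => pd2 (pd2 F) z 0) 0 := hFww.curry_left
  have hreal := hF.2
  have hpd1 := hF.pd1_zero_eq_conj
  set f : ℂ → ℂ := fun z => (pd2 F z 0 - pd2 F 0 0) / c with hf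
  have hfa : AnalyticAt ℂ f 0 := (hFw0.sub analyticAt_const).div_const
  have hf0 : f 0 = 0 := by simp [hf]
  have hdf : deriv f = fun z => pd1 (pd2 F) z 0 / c := by
    ext z
    simp [hf, pd1]
  have hdf0 : deriv f 0 = c := by
    rw [hdf]
    field_simp
    exact hcc.symm
  have hddf0 : deriv (deriv f) 0 = pd1 (pd1 (pd2 F)) 0 0 / c := by
    rw [hdf, deriv_div_const]
    rfl
  obtain ⟨φ, hφa, hφ0, hφf, hfφ⟩ := hfa.exists_local_inverse hf0 (hdf0 ▸ hc0)
  have hdφ : deriv φ 0 = 1 / c := by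
    have h : (fun x => f (φ x)) =ᶠ[𝓝 0] id := hfφ
    have h1 := (deriv_comp_eventuallyEq (A := f) (by rwa [hφ0]) hφa).eq_of_nhds
    rw [h.deriv_eq, hφ0, hdf0, deriv_id] at h1
    field_simp
    linear_combination -h1
  have hddφ : deriv (deriv φ) 0 = - (pd1 (pd1 (pd2 F)) 0 0 / c ^ 4) := by
    have h : (fun x => f (φ x)) =ᶠ[𝓝 0] id := hfφ
    have h1 := deriv_deriv_comp (A := f) (φ := φ) (p := 0) (by rwa [hφ0]) hφa
    rw [h.deriv.deriv_eq, hφ0, hdf0, hddf0, hdφ, deriv_id', deriv_const] at h1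
    field_simp at h1 ⊢
    linear_combination -h1
  set ψ : ℂ → ℂ := fun y => conj (φ (conj y)) with hψ
  have hψa : AnalyticAt ℂ ψ 0 := analyticAt_conj_comp_conj (by rwa [map_zero])
  have hψ0 : ψ 0 = 0 := by simp [hψ, hφ0]
  have hdψ : deriv ψ 0 = 1 / c := by
    have h := (hasDerivAt_conj_comp_conj (k := φ) (z := 0)
      (by rw [map_zero]; exact hφa.differentiableAt)).deriv
    rw [map_zero, hdφ, map_div₀, map_one, hcconj] at h
    exact h
  have hφt : Tendsto φ (𝓝 0) (𝓝 0) := by simpa only [hφ0] using hφa.continuousAt.tendsto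
  have hψt : Tendsto ψ (𝓝 0) (𝓝 0) := by simpa only [hψ0] using hψa.continuousAt.tendsto
  have hconj : Tendsto (fun y : ℂ => conj y) (𝓝 0) (𝓝 0) :=
    Complex.continuous_conj.tendsto' _ _ (map_zero _)
  have hFwφ : ∀ᶠ x in 𝓝 0, pd2 F (φ x) 0 - pd2 F 0 0 = c * x := by
    filter_upwards [hfφ] with x hx
    simp only [hf] at hx
    field_simp at hx
    linear_combination hx
  have hcurry : ∀ᶠ x in 𝓝 0, AnalyticAt ℂ (F (φ x)) 0 := by
    have h : Tendsto (fun x => (φ x, (0 : ℂ))) (𝓝 0) (𝓝 (0 : ℂ × ℂ)) :=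
      hφt.prodMk_nhds tendsto_const_nhds
    filter_upwards [h.eventually hFa.eventually_analyticAt] with x hx
    exact hx.curry_right
  have hcurry' : ∀ᶠ y in 𝓝 0, AnalyticAt ℂ (fun t => F t (ψ y)) 0 := by
    have h : Tendsto (fun y => ((0 : ℂ), ψ y)) (𝓝 0) (𝓝 (0 : ℂ × ℂ)) :=
      tendsto_const_nhds.prodMk_nhds hψt
    filter_upwards [h.eventually hFa.eventually_analyticAt] with x hx
    exact hx.curry_left
  set F' : ℂ → ℂ → ℂ := fun x y => F (φ x) (ψ y) - F (φ x) 0 - F 0 (ψ y) with hF'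
  refine ⟨f, fun z => -2 * F z 0, hfa, analyticAt_const.mul hFz0, hf0, by simp [hF0],
    hdf0 ▸ hc0, F', ?_, ?_, ?_, ?_, ?_⟩
  · have h1 : AnalyticAt ℂ (fun p : ℂ × ℂ => φ p.1) 0 :=
      AnalyticAt.comp (g := φ) hφa analyticAt_fst
    have h2 : AnalyticAt ℂ (fun p : ℂ × ℂ => ψ p.2) 0 :=
      AnalyticAt.comp (g := ψ) hψa analyticAt_snd
    have e1 : φ (0 : ℂ × ℂ).1 = 0 := hφ0
    have e2 : ψ (0 : ℂ × ℂ).2 = 0 := hψ0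
    refine ((AnalyticAt.comp₂ (h := fun p : ℂ × ℂ => F p.1 p.2) ?_ h1 h2).sub
      (AnalyticAt.fun_comp (g := fun z => F z 0) ?_ h1)).sub
      (AnalyticAt.fun_comp (g := fun w => F 0 w) ?_ h2)
    · rw [e1, e2]; exact hFa
    · rw [e1]; exact hFz0
    · rw [e2]; exact hF0w
  · have t1 : Tendsto (fun p : ℂ × ℂ => p.1) (𝓝 0) (𝓝 0) := continuous_fst.tendsto' _ _ rfl
    have t2 : Tendsto (fun p : ℂ × ℂ => p.2) (𝓝 0) (𝓝 0) := continuous_snd.tendsto' _ _ rfl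
    have t3 : Tendsto (fun p : ℂ × ℂ => ((0 : ℂ), p.2)) (𝓝 0) (𝓝 0) :=
      Continuous.tendsto' (by fun_prop) _ _ rfl
    filter_upwards [t1.eventually hφf, (hconj.comp t2).eventually hφf, t3.eventually hreal]
      with p h1 h2 h3
    have h4 : ψ (conj (f (conj p.2))) = p.2 := by
      simp only [hψ, Complex.conj_conj]
      simp only [Function.comp_apply] at h2
      rw [h2, Complex.conj_conj]
    simp only [map_zero] at h3
    simp only [hF', h1, h4, h3, map_mul, map_neg, Complex.conj_ofNat]
    ring
  · filter_upwards [hFwφ, hcurry] with x hx hxa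
    refine ⟨by simp [hF', hψ0, hF0], ?_⟩
    have h1 : HasDerivAt (fun y => F (φ x) (ψ y)) (deriv (F (φ x)) 0 * (1 / c)) 0 := by
      rw [← hdψ]
      refine HasDerivAt.comp (h₂ := F (φ x)) 0 ?_ hψa.differentiableAt.hasDerivAt
      rw [hψ0]
      exact hxa.differentiableAt.hasDerivAt
    have h2 : HasDerivAt (fun y => F 0 (ψ y)) (deriv (F 0) 0 * (1 / c)) 0 := by
      rw [← hdψ]
      refine HasDerivAt.comp (h₂ := F 0) 0 ?_ hψa.differentiableAt.hasDerivAt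
      rw [hψ0]
      exact hF0w.differentiableAt.hasDerivAt
    have h3 := ((h1.sub_const (F (φ x) 0)).sub h2).deriv
    refine h3.trans ?_
    simp only [pd2] at hx
    field_simp
    linear_combination hx
  · filter_upwards [hψt.eventually hpd1, hconj.eventually hFwφ, hcurry']
      with y hy hy2 hya
    refine ⟨by simp [hF', hφ0, hF0], ?_⟩
    have h1 : HasDerivAt (fun x => F (φ x) (ψ y)) (deriv (fun t => F t (ψ y)) 0 * (1 / c)) 0 := by
      rw [← hdφ]
      refine HasDerivAt.comp (h₂ := fun t => F t (ψ y)) 0 ?_ hφa.differentiableAt.hasDerivAt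
      rw [hφ0]
      exact hya.differentiableAt.hasDerivAt
    have h2 : HasDerivAt (fun x => F (φ x) 0) (deriv (fun t => F t 0) 0 * (1 / c)) 0 := by
      rw [← hdφ]
      refine HasDerivAt.comp (h₂ := fun t => F t 0) 0 ?_ hφa.differentiableAt.hasDerivAt
      rw [hφ0]
      exact hFz0.differentiableAt.hasDerivAt
    have h3 := ((h1.sub h2).sub_const (F 0 (ψ y))).deriv
    refine h3.trans ?_
    have hy0 := hpd1.self_of_nhds
    rw [map_zero] at hy0
    have hy3 := congrArg conj hy2
    simp only [hψ, Complex.conj_conj] at hy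
    rw [map_sub, ← hy, ← hy0, map_mul, hcconj, Complex.conj_conj] at hy3
    simp only [pd1] at hy3
    field_simp
    linear_combination hy3
  · have key : (fun x => pd2 (pd2 F') x 0) =ᶠ[𝓝 0] fun x =>
        (pd2 (pd2 F) (φ x) 0 - pd2 (pd2 F) 0 0) * (1 / c) ^ 2 +
          (c * deriv (deriv ψ) 0) * x := by
      filter_upwards [hFwφ, hcurry] with x hx hxa
      have b1 := deriv_deriv_comp (A := F (φ x)) (φ := ψ) (p := 0) (by rwa [hψ0]) hψa
      have b2 := deriv_deriv_comp (A := F 0) (φ := ψ) (p := 0) (by rw [hψ0]; exact hF0w) hψa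
      have b3 := deriv_deriv_sub_const_sub (p := 0) (F (φ x) 0)
        (AnalyticAt.fun_comp (g := F (φ x)) (f := ψ) (by rwa [hψ0]) hψa)
        (AnalyticAt.fun_comp (g := F 0) (f := ψ) (by rw [hψ0]; exact hF0w) hψa)
      rw [b1, b2, hψ0, hdψ] at b3
      refine Eq.trans b3 ?_
      simp only [pd2] at hx ⊢
      linear_combination deriv (deriv ψ) 0 * hx
    have hM := deriv_deriv_comp (A := fun z => pd2 (pd2 F) z 0) (φ := φ) (p := 0)
      (by rwa [hφ0]) hφa
    have hlin := deriv_deriv_mul_add_linear (p := 0) (pd2 (pd2 F) 0 0) ((1 / c) ^ 2)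
      (c * deriv (deriv ψ) 0)
      (AnalyticAt.fun_comp (g := fun z => pd2 (pd2 F) z 0) (f := φ) (by rwa [hφ0]) hφa)
    rw [hM, hφ0, hdφ, hddφ, ← key.deriv.deriv_eq] at hlin
    have e22 : coeff2 F' 2 2 = deriv (deriv fun x => pd2 (pd2 F') x 0) 0 / 4 := by
      have : coeff2 F' 2 2 = deriv (deriv fun x => pd2 (pd2 F') x 0) 0 /
        (((2).factorial : ℂ) * ((2).factorial : ℂ)) := rfl
      rw [this]
      norm_num [Nat.factorial]
    have f22 : coeff2 F 2 2 = deriv (deriv fun x => pd2 (pd2 F) x 0) 0 / 4 := by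
      have : coeff2 F 2 2 = deriv (deriv fun x => pd2 (pd2 F) x 0) 0 /
        (((2).factorial : ℂ) * ((2).factorial : ℂ)) := rfl
      rw [this]
      norm_num [Nat.factorial]
    have f12 : coeff2 F 1 2 = deriv (fun x => pd2 (pd2 F) x 0) 0 / 2 := by
      have : coeff2 F 1 2 = deriv (fun x => pd2 (pd2 F) x 0) 0 /
        (((1).factorial : ℂ) * ((2).factorial : ℂ)) := rfl
      rw [this]
      norm_num [Nat.factorial]
    have f21 : coeff2 F 2 1 = pd1 (pd1 (pd2 F)) 0 0 / 2 := by
      have : coeff2 F 2 1 = pd1 (pd1 (pd2 F)) 0 0 /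
        (((2).factorial : ℂ) * ((1).factorial : ℂ)) := rfl
      rw [this]
      norm_num [Nat.factorial]
    rw [e22, hlin, h11, f22, f12, f21, ← hcc]
    field_simp
    ring
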